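/- arXiv:1407.0643 — 3 statements merged into one kernel-verified Lean document; each statement's English description precedes it below -/
import Mathlib

section
/- Let H be a connected simple graph on n vertices and let α be a real number with α ≥ n. Then for every Nash equilibrium σ of the max-distance network creation game on H with G(σ) connected and every strategy profile τ with G(τ) connected, SC(σ) ≤ 2·SC(τ). (That is, for α ≥ n the price of anarchy is at most 2.) -/
open scoped ENNReal Classical

namespace NCG

variable {V : Type*}

/-- A strategy profile is valid w.r.t. host graph `H` if each player only buys
edges of `H` incident to it. -/
def Valid (H : SimpleGraph V) (σ : V → Finset V) : Prop :=
  ∀ v, ∀ w ∈ σ v, H.Adj v w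

/-- The graph created by a strategy profile: `u` and `v` are adjacent iff one
of them bought the edge towards the other. -/
def created (σ : V → Finset V) : SimpleGraph V :=
  SimpleGraph.fromRel (fun u v => v ∈ σ u)

/-- Eccentricity of a vertex (`⊤` if the graph is disconnected). -/
noncomputable def ecc (G : SimpleGraph V) (v : V) : ℕ∞ :=
  ⨆ u, G.edist v u

/-- Radius of a graph. -/
noncomputable def radius (G : SimpleGraph V) : ℕ∞ :=
  ⨅ v, ecc G v

/-- The cost of player `v` under strategy profile `σ`, with edge price `α`:
`α` times the number of bought edges plus the eccentricity of `v` in the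
created graph. -/
noncomputable def cost (α : ℝ) (σ : V → Finset V) (v : V) : ℝ≥0∞ :=
  ENNReal.ofReal α * (σ v).card + (ecc (created σ) v : ℝ≥0∞)

/-- Nash equilibrium: no player can strictly decrease its own cost by
unilaterally switching to another valid strategy. -/
def IsNE [DecidableEq V] (H : SimpleGraph V) (α : ℝ) (σ : V → Finset V) : Prop :=
  Valid H σ ∧ ∀ v (s : Finset V), (∀ w ∈ s, H.Adj v w) →
    cost α σ v ≤ cost α (Function.update σ v s) v

/-- Social cost of a strategy profile. -/
noncomputable def SC [Fintype V] (α : ℝ) (σ : V → Finset V) : ℝ≥0∞ :=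
  ∑ v, cost α σ v

end NCG

namespace NCG

variable {V : Type*}

theorem created_adj {σ : V → Finset V} {u v : V} :
    (created σ).Adj u v ↔ u ≠ v ∧ (v ∈ σ u ∨ u ∈ σ v) :=
  Iff.rfl

/-- In a connected graph every eccentricity is smaller than the number of vertices. -/
theorem ecc_add_one_le_card [Fintype V] {G : SimpleGraph V} (hG : G.Connected) (v : V) :
    ((ecc G v : ℕ∞) : ℝ≥0∞) + 1 ≤ Fintype.card V := by
  have hpos : 0 < Fintype.card V := Fintype.card_pos_iff.2 ⟨v⟩
  have h : ecc G v ≤ ((Fintype.card V - 1 : ℕ) : ℕ∞) := by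
    refine iSup_le fun u => ?_
    obtain ⟨p, hp, hlen⟩ := hG.exists_path_of_dist v u
    have := hp.length_lt
    refine p.edist_le.trans ?_
    exact_mod_cast (by omega : p.length ≤ Fintype.card V - 1)
  have h' : ((ecc G v : ℕ∞) : ℝ≥0∞) ≤ ((Fintype.card V - 1 : ℕ) : ℝ≥0∞) := by
    simpa using ENat.toENNReal_le.2 h
  calc _ ≤ ((Fintype.card V - 1 : ℕ) : ℝ≥0∞) + 1 := by gcongr
    _ = ((Fintype.card V - 1 + 1 : ℕ) : ℝ≥0∞) := by push_cast; rfl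
    _ = Fintype.card V := by rw [Nat.sub_add_cancel hpos]

/-- The edge joining a player to a vertex towards which an edge was bought. -/
def boughtEdge {σ : V → Finset V} (x : (v : V) × {w // w ∈ σ v}) : Sym2 V :=
  s(x.1, x.2.1)

theorem edgeSet_subset_range_boughtEdge (σ : V → Finset V) :
    (created σ).edgeSet ⊆ Set.range (boughtEdge (σ := σ)) := by
  intro e
  induction e with
  | _ u v =>
    rintro ⟨-, h | h⟩
    · exact ⟨⟨u, v, h⟩, rfl⟩
    · exact ⟨⟨v, u, h⟩, Sym2.eq_swap⟩

theorem card_sigma_bought [Fintype V] (σ : V → Finset V) :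
    Nat.card ((v : V) × {w // w ∈ σ v}) = ∑ v, (σ v).card := by
  simp [Nat.card_eq_fintype_card]

/-- Creating a connected graph requires buying at least `n - 1` edges. -/
theorem card_le_sum_card_add_one [Fintype V] {σ : V → Finset V}
    (h : (created σ).Connected) : Fintype.card V ≤ ∑ v, (σ v).card + 1 := by
  have h1 := h.card_vert_le_card_edgeSet_add_one
  have h2 : Nat.card (created σ).edgeSet ≤ Nat.card (Set.range (boughtEdge (σ := σ))) :=
    Nat.card_mono (Set.toFinite _) (edgeSet_subset_range_boughtEdge σ)
  have h3 := Finite.card_range_le (boughtEdge (σ := σ))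
  rw [card_sigma_bought] at h3
  rw [Nat.card_eq_fintype_card] at h1
  omega

theorem SC_eq [Fintype V] (α : ℝ) (σ : V → Finset V) :
    SC α σ = ENNReal.ofReal α * ((∑ v, (σ v).card : ℕ) : ℝ≥0∞) +
      ∑ v, ((ecc (created σ) v : ℕ∞) : ℝ≥0∞) := by
  simp [SC, cost, Finset.sum_add_distrib, Finset.mul_sum]

theorem deleteEdges_le_created_erase [DecidableEq V] (σ : V → Finset V) (v w : V) :
    (created σ).deleteEdges {s(v, w)} ≤
      created (Function.update σ v ((σ v).erase w)) := by
  intro a b hab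
  rw [SimpleGraph.deleteEdges_adj, created_adj] at hab
  obtain ⟨⟨hne, hab⟩, hmem⟩ := hab
  rw [Set.mem_singleton_iff, Sym2.eq_iff] at hmem
  refine created_adj.2 ⟨hne, ?_⟩
  simp only [Function.update_apply]
  grind

variable [Fintype V] [DecidableEq V] {H : SimpleGraph V} {α : ℝ} {σ : V → Finset V}

/-- If `α ≥ n`, dropping a bought edge in a connected equilibrium disconnects the graph. -/
theorem IsNE.not_connected_erase (hα : (Fintype.card V : ℝ) ≤ α) (hNE : IsNE H α σ)
    {v w : V} (hw : w ∈ σ v) :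
    ¬ (created (Function.update σ v ((σ v).erase w))).Connected := by
  intro hc
  have h := hNE.2 v ((σ v).erase w) fun x hx => hNE.1 v x (Finset.mem_of_mem_erase hx)
  have hecc := ecc_add_one_le_card hc v
  have hαn : (Fintype.card V : ℝ≥0∞) ≤ ENNReal.ofReal α := by
    simpa using ENNReal.ofReal_le_ofReal hα
  simp only [cost, Function.update_self] at h
  rw [← Finset.card_erase_add_one hw] at h
  set k := ((σ v).erase w).card
  set e := ((ecc (created (Function.update σ v ((σ v).erase w))) v : ℕ∞) : ℝ≥0∞)
  have he : e ≠ ⊤ :=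
    ne_top_of_le_ne_top (ENNReal.natCast_ne_top _) (le_self_add.trans hecc)
  have hk : ENNReal.ofReal α * k ≠ ⊤ :=
    ENNReal.mul_ne_top ENNReal.ofReal_ne_top (ENNReal.natCast_ne_top _)
  have h2 : ENNReal.ofReal α * k + (e + 1) ≤ ENNReal.ofReal α * k + e := calc
    _ ≤ ENNReal.ofReal α * k + ENNReal.ofReal α := by gcongr; exact hecc.trans hαn
    _ = ENNReal.ofReal α * ((k + 1 : ℕ) : ℝ≥0∞) := by push_cast; ring
    _ ≤ _ := le_self_add.trans h
  exact absurd ((ENNReal.add_le_add_iff_left hk).1 h2) (not_le.2 (ENNReal.lt_add_right he one_ne_zero))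

/-- If `α ≥ n`, a connected equilibrium is a tree. -/
theorem IsNE.isTree (hα : (Fintype.card V : ℝ) ≤ α) (hNE : IsNE H α σ)
    (hσ : (created σ).Connected) : (created σ).IsTree := by
  have key : ∀ v w, w ∈ σ v → (created σ).IsBridge s(v, w) := by
    intro v w hw
    by_contra hb
    exact hNE.not_connected_erase hα hw
      ((hσ.connected_delete_edge_of_not_isBridge hb).mono (deleteEdges_le_created_erase σ v w))
  refine ⟨hσ, SimpleGraph.isAcyclic_iff_forall_adj_isBridge.2 ?_⟩
  rintro v w ⟨-, hw | hw⟩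
  · exact key v w hw
  · exact Sym2.eq_swap (a := v) ▸ key w v hw

/-- If `α ≥ n`, no edge is bought from both sides in a connected equilibrium. -/
theorem IsNE.boughtEdge_injective (hα : (Fintype.card V : ℝ) ≤ α) (hNE : IsNE H α σ)
    (hσ : (created σ).Connected) : Function.Injective (boughtEdge (σ := σ)) := by
  rintro ⟨v, w, hw⟩ ⟨v', w', hw'⟩ h
  obtain ⟨rfl, rfl⟩ | ⟨rfl, rfl⟩ := Sym2.eq_iff.1 h
  · rfl
  · refine absurd (hσ.mono fun a b hab => ?_) (hNE.not_connected_erase hα hw)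
    have hne := (hNE.1 _ _ hw).ne
    obtain ⟨hab', hab⟩ := created_adj.1 hab
    refine created_adj.2 ⟨hab', ?_⟩
    simp only [Function.update_apply]
    grind

theorem IsNE.sum_card_add_one_le (hα : (Fintype.card V : ℝ) ≤ α) (hNE : IsNE H α σ)
    (hσ : (created σ).Connected) : ∑ v, (σ v).card + 1 ≤ Fintype.card V := by
  have hinj := hNE.boughtEdge_injective hα hσ
  have hmem : ∀ x, boughtEdge (σ := σ) x ∈ (created σ).edgeFinset := fun ⟨v, w, hw⟩ =>
    SimpleGraph.mem_edgeFinset.2 ⟨(hNE.1 v w hw).ne, Or.inl hw⟩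
  rw [← (hNE.isTree hα hσ).card_edgeFinset, ← card_sigma_bought, Nat.card_eq_fintype_card,
    ← Finset.card_univ]
  exact Nat.succ_le_succ (Finset.card_le_card_of_injOn _ (fun x _ => hmem x) hinj.injOn)

end NCG

/-- For `α ≥ n`, the price of anarchy is at most 2: for every
connected Nash equilibrium `σ` and every connected profile `τ`,
`SC(σ) ≤ 2·SC(τ)`. -/
theorem poa_le_two_of_alpha_ge_n
    {V : Type*} [Fintype V] [DecidableEq V]
    (H : SimpleGraph V) (hH : H.Connected)
    (α : ℝ) (hα : (Fintype.card V : ℝ) ≤ α)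
    (σ : V → Finset V) (hNE : NCG.IsNE H α σ)
    (hσconn : (NCG.created σ).Connected)
    (τ : V → Finset V) (hτ : NCG.Valid H τ)
    (hτconn : (NCG.created τ).Connected) :
    NCG.SC α σ ≤ 2 * NCG.SC α τ := by
  have hm := hNE.sum_card_add_one_le hα hσconn
  have hτm := NCG.card_le_sum_card_add_one hτconn
  have hαn : (Fintype.card V : ℝ≥0∞) ≤ ENNReal.ofReal α := by
    simpa using ENNReal.ofReal_le_ofReal hα
  set m := Fintype.card V - 1 with hmdef
  have hecc : ∀ v, ((NCG.ecc (NCG.created σ) v : ℕ∞) : ℝ≥0∞) ≤ m := fun v => by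
    have h := NCG.ecc_add_one_le_card hσconn v
    have hcard : (Fintype.card V : ℝ≥0∞) = m + 1 := by
      exact_mod_cast (by omega : Fintype.card V = m + 1)
    rw [hcard] at h
    exact (ENNReal.add_le_add_iff_right ENNReal.one_ne_top).1 h
  calc NCG.SC α σ
      ≤ ENNReal.ofReal α * m + ENNReal.ofReal α * m := by
        rw [NCG.SC_eq]
        gcongr
        · omega
        · calc _ ≤ ∑ _v : V, (m : ℝ≥0∞) := Finset.sum_le_sum fun v _ => hecc v
            _ = Fintype.card V * m := by simp
            _ ≤ _ := by gcongr
    _ = 2 * (ENNReal.ofReal α * m) := (two_mul _).symm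
    _ ≤ 2 * NCG.SC α τ := by
        rw [NCG.SC_eq]
        gcongr
        refine le_add_right ?_
        gcongr
        omega
end

section
/- Let H be a connected simple graph, let α ≥ 0, and let σ be a Nash equilibrium of the max-distance network creation game on H such that G(σ) is a spanning tree of H. Then the diameter of G(σ) satisfies δ_{G(σ)} ≤ 2·(1 + α)·δ_H + 2. -/
open scoped ENNReal Classical

namespace NCG

variable {V : Type*}

lemma created_le_created_update_insert [DecidableEq V] (σ : V → Finset V) (u v : V) :
    created σ ≤ created (Function.update σ u (insert v (σ u))) := by
  have hsub : ∀ a, σ a ⊆ Function.update σ u (insert v (σ u)) a := by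
    intro a
    rcases eq_or_ne a u with rfl | h
    · simp
    · simp [h]
  intro a b hab
  simp only [created, SimpleGraph.fromRel_adj] at hab ⊢
  exact ⟨hab.1, hab.2.imp (fun h => hsub _ h) (fun h => hsub _ h)⟩

lemma ecc_created_update_insert_le [DecidableEq V] (σ : V → Finset V) {u v : V} (huv : u ≠ v) :
    ecc (created (Function.update σ u (insert v (σ u)))) u ≤ 1 + ecc (created σ) v := by
  refine iSup_le fun z => ?_
  have hadj : (created (Function.update σ u (insert v (σ u)))).Adj u v := by
    simp [created, SimpleGraph.fromRel_adj, huv]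
  calc (created (Function.update σ u (insert v (σ u)))).edist u z
      ≤ (created (Function.update σ u (insert v (σ u)))).edist u v
        + (created (Function.update σ u (insert v (σ u)))).edist v z :=
        SimpleGraph.edist_triangle
    _ ≤ 1 + (created σ).edist v z := by
        rw [SimpleGraph.edist_eq_one_iff_adj.2 hadj]
        gcongr
        exact created_le_created_update_insert σ u v
    _ ≤ 1 + ecc (created σ) v := by
        gcongr
        exact le_iSup (fun z => (created σ).edist v z) z

/-- At equilibrium, the eccentricities of adjacent vertices of the host graph differ by at
most `1 + α`, since either endpoint could buy the edge between them. -/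
lemma IsNE.ecc_le_of_adj [DecidableEq V] {H : SimpleGraph V} {α : ℝ} {σ : V → Finset V}
    (hNE : IsNE H α σ) {u v : V} (huv : H.Adj u v) :
    (ecc (created σ) u : ℝ≥0∞) ≤ (1 + ENNReal.ofReal α) + (ecc (created σ) v : ℝ≥0∞) := by
  have hvalid : ∀ w ∈ insert v (σ u), H.Adj u w := by
    intro w hw
    rcases Finset.mem_insert.1 hw with rfl | hw
    · exact huv
    · exact hNE.1 u w hw
  have hcost := hNE.2 u (insert v (σ u)) hvalid
  simp only [cost, Function.update_self] at hcost
  have hecc : (ecc (created (Function.update σ u (insert v (σ u)))) u : ℝ≥0∞)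
      ≤ 1 + (ecc (created σ) v : ℝ≥0∞) := by
    exact_mod_cast ENat.toENNReal_le.2 (ecc_created_update_insert_le σ huv.ne)
  have hcard : ((insert v (σ u)).card : ℝ≥0∞) ≤ (σ u).card + 1 := by
    exact_mod_cast Finset.card_insert_le v (σ u)
  have hfin : ENNReal.ofReal α * (σ u).card ≠ ⊤ :=
    ENNReal.mul_ne_top ENNReal.ofReal_ne_top (ENNReal.natCast_ne_top _)
  refine (ENNReal.add_le_add_iff_left hfin).1 (hcost.trans ?_)
  calc ENNReal.ofReal α * (insert v (σ u)).card
        + (ecc (created (Function.update σ u (insert v (σ u)))) u : ℝ≥0∞)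
      ≤ ENNReal.ofReal α * ((σ u).card + 1) + (1 + (ecc (created σ) v : ℝ≥0∞)) := by gcongr
    _ = _ := by ring

lemma IsNE.ecc_le_of_walk [DecidableEq V] {H : SimpleGraph V} {α : ℝ} {σ : V → Finset V}
    (hNE : IsNE H α σ) {u v : V} (p : H.Walk u v) :
    (ecc (created σ) u : ℝ≥0∞) ≤
      p.length * (1 + ENNReal.ofReal α) + (ecc (created σ) v : ℝ≥0∞) := by
  induction p with
  | nil => simp
  | cons h p ih =>
    refine (hNE.ecc_le_of_adj h).trans ((add_le_add_right ih _).trans_eq ?_)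
    rw [SimpleGraph.Walk.length_cons]
    push_cast
    ring

end NCG

namespace SimpleGraph

variable {V : Type*} {G : SimpleGraph V}

lemma Walk.dist_add_dist_le_of_mem_support {u v w : V} (p : G.Walk u v)
    (hw : w ∈ p.support) : G.dist u w + G.dist w v ≤ p.length := by
  obtain ⟨q, r, rfl⟩ := Walk.mem_support_iff_exists_append.1 hw
  rw [Walk.length_append]
  exact add_le_add (dist_le q) (dist_le r)

/-- In a tree, a vertex on the path from `x` to `y` lies on a geodesic from any vertex `z`
to `x` or to `y`. -/
lemma IsTree.dist_add_dist_le_or (hG : G.IsTree) {x y c : V} {p : G.Walk x y} (hp : p.IsPath)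
    (hc : c ∈ p.support) (z : V) :
    G.dist z c + G.dist c x ≤ G.dist z x ∨ G.dist z c + G.dist c y ≤ G.dist z y := by
  obtain ⟨q, hq⟩ := hG.connected.exists_walk_length_eq_dist z x
  obtain ⟨r, hr⟩ := hG.connected.exists_walk_length_eq_dist z y
  by_cases hcq : c ∈ q.support
  · exact .inl (hq ▸ q.dist_add_dist_le_of_mem_support hcq)
  by_cases hcr : c ∈ r.support
  · exact .inr (hr ▸ r.dist_add_dist_le_of_mem_support hcr)
  have heq : p = (q.reverse.append r).bypass :=
    congrArg Subtype.val (hG.isAcyclic.subsingleton_path x y |>.elim ⟨p, hp⟩ ⟨_, Walk.bypass_isPath _⟩)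
  have hmem := Walk.support_bypass_subset_support _ (heq ▸ hc)
  simp [hcq, hcr] at hmem

/-- A finite tree of diameter `D` has a vertex of eccentricity at most `(D + 1) / 2`. -/
lemma IsTree.exists_two_mul_dist_le [Finite V] (hG : G.IsTree) :
    ∃ c, ∀ z, 2 * G.dist c z ≤ G.diam + 1 := by
  have := hG.connected.nonempty
  have htop : G.ediam ≠ ⊤ := connected_iff_ediam_ne_top.1 hG.connected
  obtain ⟨x, y, hxy⟩ := G.exists_dist_eq_diam
  obtain ⟨p, hp, hlen⟩ := hG.connected.exists_path_of_dist x y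
  have hcx : G.dist x (p.getVert (G.diam / 2)) ≤ G.diam / 2 :=
    (dist_le (p.take _)).trans (by simp)
  have hcy : G.dist (p.getVert (G.diam / 2)) y ≤ G.diam - G.diam / 2 :=
    (dist_le (p.drop _)).trans (by simp [hlen, hxy])
  have htri := hG.connected.dist_triangle (u := x) (v := p.getVert (G.diam / 2)) (w := y)
  refine ⟨p.getVert (G.diam / 2), fun z => ?_⟩
  have hzx := dist_le_diam htop (u := z) (v := x)
  have hzy := dist_le_diam htop (u := z) (v := y)
  rw [hxy, dist_comm (u := x) (v := p.getVert _)] at htri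
  rw [dist_comm] at hcx ⊢
  rcases hG.dist_add_dist_le_or hp (p.getVert_mem_support (G.diam / 2)) z with h | h <;> omega

end SimpleGraph

/-- If a Nash equilibrium `σ` creates a (spanning) tree, then
the diameter of `G(σ)` is at most `2·(1 + α)·δ_H + 2`. -/
theorem tree_equilibrium_diameter_bound
    {V : Type*} [Fintype V] [DecidableEq V]
    (H : SimpleGraph V) (hH : H.Connected) (α : ℝ) (hα : 0 ≤ α)
    (σ : V → Finset V) (hNE : NCG.IsNE H α σ)
    (htree : (NCG.created σ).IsTree) :
    ((NCG.created σ).ediam : ℝ≥0∞) ≤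
      2 * (1 + ENNReal.ofReal α) * (H.ediam : ℝ≥0∞) + 2 := by
  have := hH.nonempty
  set T := NCG.created σ with hT
  obtain ⟨c, hc⟩ := htree.exists_two_mul_dist_le
  obtain ⟨x, y, hxy⟩ := T.exists_edist_eq_ediam_of_finite
  have htop : T.ediam ≠ ⊤ := SimpleGraph.connected_iff_ediam_ne_top.1 htree.connected
  obtain ⟨p, hp⟩ := hH.exists_walk_length_eq_edist x c
  have hlen : (p.length : ℝ≥0∞) ≤ (H.ediam : ℝ≥0∞) := by
    exact_mod_cast ENat.toENNReal_le.2 (hp.trans_le H.edist_le_ediam)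
  have hx : (T.ediam : ℝ≥0∞) ≤ (NCG.ecc T x : ℝ≥0∞) :=
    ENat.toENNReal_le.2 (hxy ▸ le_iSup (fun z => T.edist x z) y)
  have hdiam : (T.diam : ℕ∞) = T.ediam := ENat.natCast_toNat htop
  have hecc : 2 * (NCG.ecc T c : ℝ≥0∞) ≤ (T.ediam : ℝ≥0∞) + 1 := by
    have h : 2 * NCG.ecc T c ≤ T.ediam + 1 := by
      rw [NCG.ecc, ENat.mul_iSup, ← hdiam]
      refine iSup_le fun z => ?_
      rw [← (htree.connected c z).coe_dist_eq_edist]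
      exact_mod_cast hc z
    exact_mod_cast ENat.toENNReal_le.2 h
  have htop' : (T.ediam : ℝ≥0∞) ≠ ⊤ := by simpa using htop
  refine (ENNReal.add_le_add_iff_left htop').1 ?_
  calc (T.ediam : ℝ≥0∞) + T.ediam = 2 * T.ediam := (two_mul _).symm
    _ ≤ 2 * (p.length * (1 + ENNReal.ofReal α) + (NCG.ecc T c : ℝ≥0∞)) := by
        gcongr
        exact hx.trans (hNE.ecc_le_of_walk p)
    _ ≤ 2 * (H.ediam * (1 + ENNReal.ofReal α)) + (T.ediam + 1) := by
        rw [mul_add]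
        gcongr
    _ ≤ 2 * (H.ediam * (1 + ENNReal.ofReal α)) + (T.ediam + 2) := by
        gcongr
        exact one_le_two
    _ = _ := by ring
end

section
/- For every integer k ≥ 1, every vertex (i,j) of the rotated torus T_k, and every vertex (i',j') of T_k with i' = i or j' = j, the graph distance from (i',j') to the antipodal vertex (i + k, j + k) (coordinates taken modulo 2k) equals k. -/
open scoped ENNReal

/-- Vertices of the rotated torus: pairs `(i,j) ∈ ℤ_{2k} × ℤ_{2k}` with
`i + j` even. -/
def TorusVert (k : ℕ) : Type :=
  {x : ZMod (2 * k) × ZMod (2 * k) // Even (x.1 + x.2)}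

/-- The 2D-torus-rotated-45°: `(i,j)` is adjacent to the four vertices
`(i ± 1, j ± 1)` (coordinates modulo `2k`). -/
def rotatedTorus (k : ℕ) : SimpleGraph (TorusVert k) :=
  SimpleGraph.fromRel (fun a b =>
    (b.1.1 - a.1.1 = 1 ∨ b.1.1 - a.1.1 = -1) ∧
    (b.1.2 - a.1.2 = 1 ∨ b.1.2 - a.1.2 = -1))

/-- Circular distance on `ℤ_m`: `d̄(a,b) = min{r, m − r}` where `r` is the
canonical representative of `a − b`. -/
def cdist {m : ℕ} (a b : ZMod m) : ℕ :=
  min (a - b).val (m - (a - b).val)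

/-- Eccentricity of a vertex (`⊤` if the graph is disconnected). -/
noncomputable def ecc {V : Type*} (G : SimpleGraph V) (v : V) : ℕ∞ :=
  ⨆ u, G.edist v u

/-- Vertices whose coordinates differ by `±1` are adjacent. -/
theorem rotatedTorus_adj_of_sub_eq {k : ℕ} (hk : 1 ≤ k) {a b : TorusVert k} {e f : ℤ}
    (he : e = 1 ∨ e = -1) (hf : f = 1 ∨ f = -1)
    (h₁ : b.1.1 - a.1.1 = (e : ZMod (2 * k))) (h₂ : b.1.2 - a.1.2 = (f : ZMod (2 * k))) :
    (rotatedTorus k).Adj a b := by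
  have : Fact (1 < 2 * k) := ⟨by omega⟩
  rw [rotatedTorus, SimpleGraph.fromRel_adj]
  refine ⟨?_, Or.inl ⟨?_, ?_⟩⟩
  · rintro rfl
    rcases he with rfl | rfl <;> simp at h₁
  · rcases he with rfl | rfl <;> simp [h₁]
  · rcases hf with rfl | rfl <;> simp [h₂]

/-- Adjacent vertices differ by `±1` in each coordinate. -/
theorem rotatedTorus_exists_sub_eq_of_adj {k : ℕ} {a b : TorusVert k}
    (h : (rotatedTorus k).Adj a b) :
    (∃ e : ℤ, |e| ≤ 1 ∧ b.1.1 - a.1.1 = (e : ZMod (2 * k))) ∧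
      ∃ f : ℤ, |f| ≤ 1 ∧ b.1.2 - a.1.2 = (f : ZMod (2 * k)) := by
  have key : ∀ x y : ZMod (2 * k), (y - x = 1 ∨ y - x = -1) ∨ (x - y = 1 ∨ x - y = -1) →
      ∃ e : ℤ, |e| ≤ 1 ∧ y - x = (e : ZMod (2 * k)) := by
    rintro x y ((h | h) | (h | h))
    · exact ⟨1, by simp, by simp [h]⟩
    · exact ⟨-1, by simp, by simp [h]⟩
    · exact ⟨-1, by simp, by rw [← neg_sub, h]; simp⟩
    · exact ⟨1, by simp, by rw [← neg_sub, h]; simp⟩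
  rw [rotatedTorus, SimpleGraph.fromRel_adj] at h
  exact ⟨key _ _ (h.2.imp And.left And.left), key _ _ (h.2.imp And.right And.right)⟩

/-- A walk moves each coordinate by at most its length. -/
theorem rotatedTorus_exists_sub_eq_of_walk {k : ℕ} {a b : TorusVert k}
    (p : (rotatedTorus k).Walk a b) :
    (∃ e : ℤ, |e| ≤ p.length ∧ b.1.1 - a.1.1 = (e : ZMod (2 * k))) ∧
      ∃ f : ℤ, |f| ≤ p.length ∧ b.1.2 - a.1.2 = (f : ZMod (2 * k)) := by
  induction p with
  | nil => exact ⟨⟨0, by simp⟩, ⟨0, by simp⟩⟩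
  | cons h p ih =>
    obtain ⟨⟨e, he, he'⟩, f, hf, hf'⟩ := ih
    obtain ⟨⟨e₁, he₁, he₁'⟩, f₁, hf₁, hf₁'⟩ := rotatedTorus_exists_sub_eq_of_adj h
    rw [SimpleGraph.Walk.length_cons]
    refine ⟨⟨e + e₁, ?_, ?_⟩, f + f₁, ?_, ?_⟩
    · push_cast
      linarith [abs_add_le e e₁]
    · rw [Int.cast_add, ← he', ← he₁']
      ring
    · push_cast
      linarith [abs_add_le f f₁]
    · rw [Int.cast_add, ← hf', ← hf₁']
      ring

/-- A displacement of size at most `n` and of the parity of `n` in each coordinate can be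
realised in `n` steps. -/
theorem rotatedTorus_edist_le {k : ℕ} (hk : 1 ≤ k) (n : ℕ) {a b : TorusVert k} {p q : ℤ}
    (hp : |p| ≤ n) (hq : |q| ≤ n) (hpn : Even (n + p)) (hqn : Even (n + q))
    (h₁ : b.1.1 - a.1.1 = (p : ZMod (2 * k))) (h₂ : b.1.2 - a.1.2 = (q : ZMod (2 * k))) :
    (rotatedTorus k).edist a b ≤ n := by
  induction n generalizing a p q with
  | zero =>
    obtain rfl : p = 0 := by simpa using hp
    obtain rfl : q = 0 := by simpa using hq
    have hab : a = b := by
      refine Subtype.ext (Prod.ext ?_ ?_)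
      · exact (sub_eq_zero.mp (by simpa using h₁)).symm
      · exact (sub_eq_zero.mp (by simpa using h₂)).symm
    simp [hab]
  | succ n ih =>
    have step : ∀ p : ℤ, |p| ≤ (n + 1 : ℕ) → Even (((n + 1 : ℕ) : ℤ) + p) →
        ∃ e : ℤ, (e = 1 ∨ e = -1) ∧ |p - e| ≤ n ∧ Even ((n : ℤ) + (p - e)) := by
      intro p hp hpn
      rw [abs_le] at hp
      simp only [abs_le, Int.even_iff] at hpn ⊢
      by_cases h : 0 ≤ p
      · exact ⟨1, by omega, by omega, by omega⟩
      · exact ⟨-1, by omega, by omega, by omega⟩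
    obtain ⟨e, he, hpe, hpe'⟩ := step p hp hpn
    obtain ⟨f, hf, hqf, hqf'⟩ := step q hq hqn
    have heven : Even ((a.1.1 + (e : ZMod (2 * k))) + (a.1.2 + (f : ZMod (2 * k)))) := by
      have hef : Even (e + f) := by rcases he with rfl | rfl <;> rcases hf with rfl | rfl <;> decide
      have := a.2.add (hef.map (Int.castRingHom (ZMod (2 * k))))
      rw [add_add_add_comm]
      simpa using this
    let c : TorusVert k := ⟨(a.1.1 + (e : ZMod (2 * k)), a.1.2 + (f : ZMod (2 * k))), heven⟩
    have hac : (rotatedTorus k).Adj a c :=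
      rotatedTorus_adj_of_sub_eq hk he hf (add_sub_cancel_left _ _) (add_sub_cancel_left _ _)
    have hcb : (rotatedTorus k).edist c b ≤ n := by
      refine ih hpe hqf hpe' hqf' ?_ ?_
      · rw [Int.cast_sub, ← h₁, sub_sub]
      · rw [Int.cast_sub, ← h₂, sub_sub]
    calc (rotatedTorus k).edist a b
        ≤ (rotatedTorus k).edist a c + (rotatedTorus k).edist c b :=
          SimpleGraph.edist_triangle
      _ ≤ 1 + n := add_le_add (SimpleGraph.edist_eq_one_iff_adj.mpr hac).le hcb
      _ = (n + 1 : ℕ) := by rw [add_comm]; norm_cast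

/-- An integer congruent to `k` modulo `2 * k` has absolute value at least `k`. -/
theorem le_abs_of_intCast_eq {k : ℕ} {e : ℤ}
    (h : (k : ZMod (2 * k)) = (e : ZMod (2 * k))) : (k : ℤ) ≤ |e| := by
  have h' : ((k : ℤ) : ZMod (2 * k)) = (e : ZMod (2 * k)) := by simpa using h
  rw [ZMod.intCast_eq_intCast_iff_dvd_sub] at h'
  obtain ⟨c, hc⟩ := h'
  push_cast at hc
  obtain rfl : e = k * (2 * c + 1) := by linarith
  rw [abs_mul, Nat.abs_cast]
  exact le_mul_of_one_le_right (by positivity) (Int.one_le_abs (by omega))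

/-- An integer whose class modulo `2 * k` is even is even. -/
theorem even_of_even_intCast {k : ℕ} {z : ℤ} (h : Even (z : ZMod (2 * k))) : Even z := by
  have := h.map (ZMod.castHom (dvd_mul_right 2 k) (ZMod 2))
  rw [map_intCast] at this
  obtain ⟨r, hr⟩ := this
  rw [CharTwo.add_self_eq_zero] at hr
  exact (ZMod.intCast_eq_zero_iff_even).mp hr

/-- Every class modulo `2 * k` has a representative of absolute value at most `k`. -/
theorem exists_intCast_eq_abs_le {k : ℕ} (hk : 1 ≤ k) (x : ZMod (2 * k)) :
    ∃ d : ℤ, |d| ≤ k ∧ x = (d : ZMod (2 * k)) := by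
  have : NeZero (2 * k) := ⟨by omega⟩
  refine ⟨x.valMinAbs, ?_, x.coe_valMinAbs.symm⟩
  have := x.natAbs_valMinAbs_le
  rw [Int.abs_eq_natAbs]
  omega

/-- If one coordinate of `a - w` is `k`, then `w` and `a` are at distance at least `k`. -/
theorem rotatedTorus_le_edist {k : ℕ} {a w : TorusVert k}
    (h : a.1.1 - w.1.1 = (k : ZMod (2 * k)) ∨ a.1.2 - w.1.2 = (k : ZMod (2 * k))) :
    (k : ℕ∞) ≤ (rotatedTorus k).edist w a := by
  refine le_iInf fun p => ?_
  obtain ⟨⟨e, he, he'⟩, f, hf, hf'⟩ := rotatedTorus_exists_sub_eq_of_walk p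
  rcases h with h | h
  · exact_mod_cast (le_abs_of_intCast_eq (h.symm.trans he')).trans he
  · exact_mod_cast (le_abs_of_intCast_eq (h.symm.trans hf')).trans hf

/-- for every vertex `(i,j)` of the rotated torus and every
vertex `(i',j')` with `i' = i` or `j' = j`, the distance from `(i',j')` to the
antipodal vertex `(i + k, j + k)` equals `k`. -/
theorem rotatedTorus_dist_to_antipode (k : ℕ) (hk : 1 ≤ k)
    (v w a : TorusVert k)
    (hw : w.1.1 = v.1.1 ∨ w.1.2 = v.1.2)
    (ha : a.1 = (v.1.1 + (k : ZMod (2 * k)), v.1.2 + (k : ZMod (2 * k)))) :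
    (rotatedTorus k).edist w a = (k : ℕ∞) := by
  have hd : a.1.1 - w.1.1 = (k : ZMod (2 * k)) ∨ a.1.2 - w.1.2 = (k : ZMod (2 * k)) := by
    rw [ha]
    exact hw.imp (fun h => by simp [h]) (fun h => by simp [h])
  refine le_antisymm ?_ (rotatedTorus_le_edist hd)
  have hsum : Even ((a.1.1 - w.1.1) + (a.1.2 - w.1.2)) := by
    rw [← add_sub_add_comm]
    exact a.2.sub w.2
  rcases hd with h | h
  · obtain ⟨d, hdk, hd'⟩ := exists_intCast_eq_abs_le hk (a.1.2 - w.1.2)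
    rw [h, hd'] at hsum
    exact rotatedTorus_edist_le hk k (p := k) (q := d) (by simp) hdk (by simp)
      (even_of_even_intCast (by simpa using hsum)) (by simpa using h) hd'
  · obtain ⟨d, hdk, hd'⟩ := exists_intCast_eq_abs_le hk (a.1.1 - w.1.1)
    rw [h, hd', add_comm] at hsum
    exact rotatedTorus_edist_le hk k (p := d) (q := k) hdk (by simp)
      (even_of_even_intCast (by simpa using hsum)) (by simp) hd' (by simpa using h)
end
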